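/- arXiv:1907.08122 — 2 statements merged into one kernel-verified Lean document; each statement's English description precedes it below -/
import Mathlib

section
/- Let q be an odd prime power with q ≡ 2 or 3 (mod 5), and let c ∈ F_{q^6} satisfy c^2 + c = 1. Then the following are equivalent: (i) there exist γ, β ∈ F_{q^6} satisfying (c − γ)·( −(c − γ)^{q^4+q^2} + β^{q^5+q^4}·(c − γ)^{q^4+q^3+q^2} + β^{q^2+q} ) = 1 and γ = −(c − γ)^{q^2+1} + β^{q^3+q^2}·(c − γ)^{q^2+q+1}; (ii) there exists γ ∈ F_{q^6} with γ ≠ c satisfying γ = −γ^{q^3}·(c − γ)^{q^2+q+1} and ( (c − γ)^{−1} − γ^{q^2} )^{(q^6−1)/(q+1)} = 1. -/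
/-- In a finite field with `q ^ k` elements, the map `x ↦ x ^ q` is a ring homomorphism. -/
theorem exists_ringHom_eq_pow {F : Type*} [Field F] [Fintype F] {q k : ℕ} (hq : IsPrimePow q)
    (hcard : Fintype.card F = q ^ k) :
    ∃ φ : F →+* F, ∀ x, φ x = x ^ q := by
  obtain ⟨p, n, hp, -, rfl⟩ := hq
  obtain ⟨r, hr, m, hrm⟩ := FiniteField.card' F
  have hdvd : (r : ℕ) ∣ p := by
    have h : (r : ℕ) ∣ (p ^ n) ^ k := by
      rw [← hcard, hrm.2]
      exact dvd_pow_self _ (PNat.ne_zero _)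
    exact hrm.1.dvd_of_dvd_pow (hrm.1.dvd_of_dvd_pow h)
  obtain rfl : r = p := (Nat.prime_dvd_prime_iff_eq hrm.1 hp.nat_prime).1 hdvd
  have : Fact r.Prime := ⟨hrm.1⟩
  exact ⟨iterateFrobenius F r n, fun x => iterateFrobenius_def r n x⟩

/-- In a finite field, an element killed by `(#F - 1) / d` is a `d`-th power. -/
theorem exists_pow_eq_of_pow_div_eq_one {F : Type*} [Field F] [Fintype F] {d : ℕ}
    (hd : d ∣ Fintype.card F - 1) {b : F}
    (hb : b ≠ 0) (h : b ^ ((Fintype.card F - 1) / d) = 1) : ∃ z : F, z ^ d = b := by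
  obtain ⟨g, hg⟩ := IsCyclic.exists_generator (α := Fˣ)
  obtain ⟨m, hm⟩ := Submonoid.mem_powers_iff _ _ |>.1
    (mem_powers_iff_mem_zpowers.2 (hg (Units.mk0 b hb)))
  have hord : orderOf g = Fintype.card F - 1 := by
    rw [orderOf_eq_card_of_forall_mem_zpowers hg, Nat.card_units, Nat.card_eq_fintype_card]
  have hcard : 0 < Fintype.card F - 1 := by
    have := Fintype.one_lt_card (α := F)
    omega
  obtain ⟨t, ht⟩ := hd
  rw [ht] at hcard
  have hdpos : 0 < d := pos_of_mul_pos_left hcard (Nat.zero_le _)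
  have htpos : 0 < t := pos_of_mul_pos_right hcard (Nat.zero_le _)
  rw [ht, Nat.mul_div_cancel_left _ hdpos] at h
  have hone : g ^ (m * t) = 1 := by
    rw [pow_mul, hm]
    ext
    simpa using h
  have hdvd := orderOf_dvd_of_pow_eq_one hone
  rw [hord, ht] at hdvd
  obtain ⟨s, rfl⟩ := Nat.dvd_of_mul_dvd_mul_right htpos hdvd
  refine ⟨((g ^ s : Fˣ) : F), ?_⟩
  rw [← Units.val_pow_eq_pow_val, ← pow_mul, mul_comm, hm, Units.val_mk0]

/-- The three cyclic relations below are incompatible when `c ^ 2 + c = 1`. -/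
theorem cyclic_relations_incompatible {F : Type*} [Field F] {c x y z : F} (hc : c ^ 2 + c = 1)
    (hxyz : x * y * z = -1) (hxy : x * y = c * x - 1) (hyz : y * z = c * y - 1)
    (hzx : z * x = c * z - 1) : False := by
  have hc0 : c ≠ 0 := by
    rintro rfl
    simp at hc
  have hx : c * x = 1 - c := by linear_combination -hxyz + x * hyz + c * hxy + x * hc
  have hy : c * y = 1 - c := by linear_combination -hxyz + y * hzx + c * hyz + y * hc
  have h : c ^ 3 * (c + 1) = 0 := by
    linear_combination c ^ 2 * hxy - c * y * hx + c ^ 2 * hx - (1 - c) * hy + (c ^ 2 + 1 - c) * hc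
  have h1 : c + 1 = 0 := (mul_eq_zero.1 h).resolve_left (pow_ne_zero _ hc0)
  have : (1 : F) = 0 := by linear_combination c * h1 - hc
  exact one_ne_zero this

theorem stmt6 (q : ℕ) (hq : IsPrimePow q) (hodd : Odd q)
    (hq5 : q % 5 = 2 ∨ q % 5 = 3)
    (F : Type*) [Field F] [Fintype F] (hcard : Fintype.card F = q ^ 6)
    (c : F) (hc : c ^ 2 + c = 1) :
    (∃ γ β : F,
        (c - γ) * (-(c - γ) ^ (q ^ 4 + q ^ 2)
            + β ^ (q ^ 5 + q ^ 4) * (c - γ) ^ (q ^ 4 + q ^ 3 + q ^ 2)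
            + β ^ (q ^ 2 + q)) = 1 ∧
        γ = -(c - γ) ^ (q ^ 2 + 1) + β ^ (q ^ 3 + q ^ 2) * (c - γ) ^ (q ^ 2 + q + 1))
      ↔ (∃ γ : F, γ ≠ c ∧
          γ = -γ ^ (q ^ 3) * (c - γ) ^ (q ^ 2 + q + 1) ∧
          ((c - γ)⁻¹ - γ ^ (q ^ 2)) ^ ((q ^ 6 - 1) / (q + 1)) = 1) := by
  obtain ⟨φ, hφ⟩ := exists_ringHom_eq_pow hq hcard
  have h2 (x : F) : x ^ (q ^ 2) = φ (φ x) := by simp only [hφ, ← pow_mul]; ring_nf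
  have h3 (x : F) : x ^ (q ^ 3) = φ (φ (φ x)) := by simp only [hφ, ← pow_mul]; ring_nf
  have h4 (x : F) : x ^ (q ^ 4) = φ (φ (φ (φ x))) := by simp only [hφ, ← pow_mul]; ring_nf
  have h5 (x : F) : x ^ (q ^ 5) = φ (φ (φ (φ (φ x)))) := by
    simp only [hφ, ← pow_mul]; ring_nf
  have h6 (x : F) : φ (φ (φ (φ (φ (φ x))))) = x := by
    have h : φ (φ (φ (φ (φ (φ x))))) = x ^ (q ^ 6) := by simp only [hφ, ← pow_mul]; ring_nf
    rw [h, ← hcard, FiniteField.pow_card]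
  have hφc : φ (φ c) = c := by
    have h : φ c ^ 2 + φ c = 1 := by rw [← map_pow, ← map_add, hc, map_one]
    have h' : (φ c - c) * (φ c + 1 + c) = 0 := by linear_combination h - hc
    rcases mul_eq_zero.1 h' with h' | h'
    · rw [sub_eq_zero.1 h', sub_eq_zero.1 h']
    · have h'' := congrArg φ h'
      simp only [map_add, map_one, map_zero] at h''
      linear_combination h'' - h'
  have hdvd : q + 1 ∣ q ^ 6 - 1 := by
    have h : q ^ 2 - 1 ∣ (q ^ 2) ^ 3 - 1 ^ 3 := Nat.sub_dvd_pow_sub_pow _ _ 3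
    rw [← pow_mul, one_pow] at h
    refine dvd_trans ⟨q - 1, ?_⟩ h
    simpa using Nat.sq_sub_sq q 1
  simp only [pow_add, h2, h3, h4, h5, ← hφ, pow_one]
  constructor
  · rintro ⟨γ, β, hA, hB⟩
    have hB2 := congrArg (fun x => φ (φ x)) hB
    simp only [map_add, map_neg, map_mul, map_sub, hφc] at hA hB hB2
    have hy : c - γ ≠ 0 := left_ne_zero_of_mul_eq_one hA
    have hb : (c - γ)⁻¹ - φ (φ γ) = φ (φ β) * φ β := by
      field_simp
      linear_combination -hA - (c - γ) * hB2
    refine ⟨γ, fun h => hy (by rw [h, sub_self]), ?_, ?_⟩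
    · have h := congrArg φ hb
      have hy1 : φ c - φ γ ≠ 0 := by rwa [← map_sub, map_ne_zero]
      simp only [map_mul, map_sub, map_inv₀, hφc] at h ⊢
      linear_combination hB - (c - φ (φ γ)) * (φ c - φ γ) * (c - γ) * h
        + (c - φ (φ γ)) * (c - γ) * mul_inv_cancel₀ hy1
    · have hβ : β ≠ 0 := by
        rintro rfl
        simp only [map_zero, mul_zero, zero_mul, add_zero] at hA hB hb
        have h0 : (c - γ) * φ (φ γ) = 1 := by rw [← sub_eq_zero.1 hb, mul_inv_cancel₀ hy]
        have h2' := congrArg (fun x => φ (φ x)) h0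
        have h4' := congrArg (fun x => φ (φ x)) h2'
        simp only [map_mul, map_sub, map_one, hφc, h6] at h2' h4'
        refine cyclic_relations_incompatible (x := c - γ) (y := c - φ (φ γ))
          (z := c - φ (φ (φ (φ γ)))) hc ?_ ?_ ?_ ?_
        · linear_combination -hA
        · linear_combination -h0
        · linear_combination -h2'
        · linear_combination -h4'
      have hpow : φ (φ β) * φ β = φ β ^ (q + 1) := by rw [pow_succ, ← hφ]
      rw [hb, hpow, ← pow_mul, Nat.mul_div_cancel' hdvd, ← hcard,
        FiniteField.pow_card_sub_one_eq_one _ ((map_ne_zero φ).2 hβ)]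
  · rintro ⟨γ, hne, hγ, hb⟩
    have hy : c - γ ≠ 0 := sub_ne_zero.2 hne.symm
    rw [← hcard] at hb hdvd
    have hb0 : (c - γ)⁻¹ - φ (φ γ) ≠ 0 := by
      intro h0
      have hlt : 0 < Fintype.card F - 1 := Nat.sub_pos_of_lt Fintype.one_lt_card
      rw [h0, zero_pow (Nat.div_pos (Nat.le_of_dvd hlt hdvd) q.succ_pos).ne'] at hb
      exact zero_ne_one hb
    obtain ⟨z, hz⟩ := exists_pow_eq_of_pow_div_eq_one hdvd hb0 hb
    rw [pow_succ, ← hφ] at hz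
    refine ⟨γ, φ (φ (φ (φ (φ z)))), ?_⟩
    have hy1 : φ c - φ γ ≠ 0 := by rwa [← map_sub, map_ne_zero]
    have hy3 : φ c - φ (φ (φ γ)) ≠ 0 := by
      rwa [← hφc, ← map_sub, ← map_sub, ← map_sub, map_ne_zero, map_ne_zero, map_ne_zero]
    have hγ2 := congrArg (fun x => φ (φ x)) hγ
    have hz1 := congrArg φ hz
    have hz4 := congrArg (fun x => φ (φ (φ x))) hz
    simp only [map_neg, map_mul, map_sub, map_inv₀, hφc, h6] at hγ hγ2 hz1 hz4 ⊢
    constructor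
    · linear_combination (c - γ) * (c - φ (φ (φ (φ γ)))) * (c - φ (φ γ)) *
          ((φ c - φ (φ (φ γ))) * hz4 + mul_inv_cancel₀ hy3)
        + (c - γ) * hz + mul_inv_cancel₀ hy - (c - γ) * hγ2
    · linear_combination hγ - (c - φ (φ γ)) * (c - γ) *
        ((φ c - φ γ) * hz1 + mul_inv_cancel₀ hy1)
end

section
/- Let q be an odd prime power and let c ∈ F_{q^6} satisfy c^2 + c = 1. Then the only β ∈ F_{q^6} satisfying β^{q^4} = c^q·β is β = 0. -/
/-- In a finite field whose order is a power of the prime power `q`, raising to the `q`-th power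
is a ring endomorphism. -/
theorem exists_ringHom_eq_pow_of_card_eq_pow {q n : ℕ} (hq : IsPrimePow q)
    {F : Type*} [Field F] [Fintype F] (hcard : Fintype.card F = q ^ n) :
    ∃ φ : F →+* F, ∀ x, φ x = x ^ q := by
  obtain ⟨p, k, hp, -, rfl⟩ := hq
  have : Fact p.Prime := ⟨hp.nat_prime⟩
  have : CharP F p := charP_of_card_eq_prime_pow (f := k * n) (by
    rw [hcard, pow_mul])
  exact ⟨iterateFrobenius F p k, fun x => iterateFrobenius_def p k x⟩

/-- A ring endomorphism of a domain acts as an involution on the roots of `X ^ 2 + X - 1`. -/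
theorem RingHom.apply_apply_of_sq_add_self_eq_one {R : Type*} [CommRing R] [IsDomain R]
    (φ : R →+* R) {d : R} (hd : d ^ 2 + d = 1) : φ (φ d) = d := by
  have hφ : φ d ^ 2 + φ d = 1 := by simpa using congrArg φ hd
  have hmul : (φ d - d) * (φ d + d + 1) = 0 := by linear_combination hφ - hd
  rcases mul_eq_zero.mp hmul with h | h
  · rw [sub_eq_zero.mp h, sub_eq_zero.mp h]
  · have h' := congrArg φ h
    simp only [map_add, map_one, map_zero] at h'
    linear_combination h' - h

/-- Away from characteristic two, a root of `X ^ 2 + X - 1` is not a cube root of unity. -/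
theorem pow_three_ne_one_of_sq_add_self_eq_one {K : Type*} [Field K] (h2 : (2 : K) ≠ 0)
    {d : K} (hd : d ^ 2 + d = 1) : d ^ 3 ≠ 1 := by
  intro h
  have h1 : d = 1 := mul_left_cancel₀ h2 (by linear_combination h - (d - 1) * hd)
  subst h1
  simp at hd

theorem stmt11 (q : ℕ) (hq : IsPrimePow q) (hodd : Odd q)
    (F : Type*) [Field F] [Fintype F] (hcard : Fintype.card F = q ^ 6)
    (c : F) (hc : c ^ 2 + c = 1) :
    ∀ β : F, β ^ (q ^ 4) = c ^ q * β → β = 0 := by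
  intro β hβ
  obtain ⟨φ, hφ⟩ := exists_ringHom_eq_pow_of_card_eq_pow hq hcard
  have h2 : (2 : F) ≠ 0 := Ring.two_ne_zero (by
    intro h
    have := FiniteField.even_card_of_char_two h
    rw [hcard] at this
    exact Nat.not_even_iff_odd.mpr hodd.pow (Nat.even_iff.mpr this))
  have hd : φ c ^ 2 + φ c = 1 := by simpa using congrArg φ hc
  have hinv := φ.apply_apply_of_sq_add_self_eq_one hd
  have hfour : φ (φ (φ (φ β))) = φ c * β := by
    simp only [hφ, ← pow_mul]
    rw [← hβ]
    ring
  have hsix : ∀ x, φ (φ (φ (φ (φ (φ x))))) = x := by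
    intro x
    simp only [hφ, ← pow_mul]
    conv_rhs => rw [← FiniteField.pow_card x, hcard]
    ring
  have htwelve : φ c ^ 3 * β = β := by
    calc φ c ^ 3 * β = φ (φ (φ (φ (φ (φ (φ (φ (φ (φ (φ (φ β))))))))))) := by
          simp only [hfour, map_mul, hinv]
          ring
      _ = β := by rw [hsix, hsix]
  by_contra hne
  exact pow_three_ne_one_of_sq_add_self_eq_one h2 hd (mul_right_cancel₀ hne (by rw [htwelve, one_mul]))
end
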